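/- For every s > 1/2 there is C > 0 such that for all u, z : ℤ → [0,∞) with ‖u‖_{ℓ²}, ‖z‖_{ℓ²} < ∞: the sum of M₂ · u(j₁) u(j₂) u(j₃) u(k₂) u(k₃) z(k) over all integer tuples with k = k₁+k₂+k₃, k₁ = j₁+j₂+j₃ and Φ(k̄) ≠ 0 is at most C ‖u‖⁵_{ℓ²} ‖z‖_{ℓ²}, where M₂ := |k| ⟨k⟩^{s} ⟨k₁⟩ / (|Φ(k̄)| ⟨j₁⟩^{s} ⟨j₂⟩^{s} ⟨j₃⟩^{s} ⟨k₂⟩^{s} ⟨k₃⟩^{s}). -/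

import Mathlib

open scoped ENNReal

/-- Japanese bracket `⟨k⟩ = 1 + |k|`. -/
noncomputable def jb (k : ℤ) : ℝ := 1 + |(k : ℝ)|

/-- `‖u‖_{ℓ²} = (∑_k u(k)²)^{1/2}`, valued in `[0,∞]`. -/
noncomputable def l2 (u : ℤ → ℝ) : ℝ≥0∞ :=
  (∑' k : ℤ, ENNReal.ofReal (u k ^ 2)) ^ (1 / 2 : ℝ)

/-- `Φ(k̄) = k³ − k₁³ − k₂³ − k₃³` with `k = k₁ + k₂ + k₃`. -/
def Phi (k₁ k₂ k₃ : ℤ) : ℤ := (k₁ + k₂ + k₃) ^ 3 - k₁ ^ 3 - k₂ ^ 3 - k₃ ^ 3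

/-- The multiplier `M₂ = |k| ⟨k⟩^s ⟨k₁⟩ / (|Φ(k̄)| ⟨j₁⟩^s ⟨j₂⟩^s ⟨j₃⟩^s ⟨k₂⟩^s ⟨k₃⟩^s)`,
where `k₁ = j₁ + j₂ + j₃` and `k = k₁ + k₂ + k₃`. -/
noncomputable def M2 (s : ℝ) (j₁ j₂ j₃ k₂ k₃ : ℤ) : ℝ :=
  |((j₁ + j₂ + j₃ + k₂ + k₃ : ℤ) : ℝ)| * jb (j₁ + j₂ + j₃ + k₂ + k₃) ^ s *
    jb (j₁ + j₂ + j₃) /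
    (|((Phi (j₁ + j₂ + j₃) k₂ k₃ : ℤ) : ℝ)| *
      jb j₁ ^ s * jb j₂ ^ s * jb j₃ ^ s * jb k₂ ^ s * jb k₃ ^ s)

lemma one_le_jb (k : ℤ) : 1 ≤ jb k := by
  unfold jb; linarith [abs_nonneg (k : ℝ)]

lemma jb_pos (k : ℤ) : 0 < jb k := zero_lt_one.trans_le (one_le_jb k)

lemma jb_add_le_mul (a b : ℤ) : jb (a + b) ≤ jb a * jb b := by
  unfold jb
  push_cast
  nlinarith [abs_add_le (a : ℝ) b, abs_nonneg (a : ℝ), abs_nonneg (b : ℝ),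
    mul_nonneg (abs_nonneg (a : ℝ)) (abs_nonneg (b : ℝ))]

lemma jb_le_two_mul_abs {a : ℤ} (ha : a ≠ 0) : jb a ≤ 2 * |(a : ℝ)| := by
  have : (1 : ℝ) ≤ |(a : ℝ)| := by exact_mod_cast Int.one_le_abs ha
  unfold jb; linarith

lemma Phi_eq (k₁ k₂ k₃ : ℤ) : Phi k₁ k₂ k₃ = 3 * (k₁ + k₂) * (k₂ + k₃) * (k₃ + k₁) := by
  unfold Phi; ring

lemma M2_nonneg (s : ℝ) (j₁ j₂ j₃ k₂ k₃ : ℤ) : 0 ≤ M2 s j₁ j₂ j₃ k₂ k₃ := by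
  have h := fun k => (jb_pos k).le
  unfold M2
  have h' := fun k => Real.rpow_nonneg (h k) s
  apply div_nonneg
  · exact mul_nonneg (mul_nonneg (abs_nonneg _) (h' _)) (h _)
  · have := h' j₁; have := h' j₂; have := h' j₃; have := h' k₂; have := h' k₃
    positivity

/-- The frequency part of `M₂` separated from the part raised to the power `s`. -/
lemma M2_eq (s : ℝ) (j₁ j₂ j₃ k₂ k₃ : ℤ) :
    M2 s j₁ j₂ j₃ k₂ k₃ =
      |((j₁ + j₂ + j₃ + k₂ + k₃ : ℤ) : ℝ)| * jb (j₁ + j₂ + j₃) /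
        |((Phi (j₁ + j₂ + j₃) k₂ k₃ : ℤ) : ℝ)| *
      (jb (j₁ + j₂ + j₃ + k₂ + k₃) / (jb j₁ * jb j₂ * jb j₃ * jb k₂ * jb k₃)) ^ s := by
  have h := fun k => (jb_pos k).le
  have h₁ := h j₁; have h₂ := h j₂; have h₃ := h j₃; have h₄ := h k₂; have h₅ := h k₃
  rw [Real.div_rpow (h _) (by positivity), Real.mul_rpow (by positivity) h₅,
    Real.mul_rpow (by positivity) h₄, Real.mul_rpow (by positivity) h₃, Real.mul_rpow h₁ h₂]
  unfold M2
  rw [div_mul_div_comm]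
  congr 1 <;> ring

lemma M2_anti {s t : ℝ} (hst : s ≤ t) (j₁ j₂ j₃ k₂ k₃ : ℤ) :
    M2 t j₁ j₂ j₃ k₂ k₃ ≤ M2 s j₁ j₂ j₃ k₂ k₃ := by
  have h₀ := jb_pos (j₁ + j₂ + j₃ + k₂ + k₃)
  have h := jb_pos (j₁ + j₂ + j₃)
  have h₁ := jb_pos j₁; have h₂ := jb_pos j₂; have h₃ := jb_pos j₃
  have h₄ := jb_pos k₂; have h₅ := jb_pos k₃
  rw [M2_eq, M2_eq]
  refine mul_le_mul_of_nonneg_left ?_ (by positivity)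
  refine Real.rpow_le_rpow_of_exponent_ge (by positivity) ?_ hst
  refine div_le_one_of_le₀ ?_ (by positivity)
  calc jb (j₁ + j₂ + j₃ + k₂ + k₃) ≤ jb (j₁ + j₂ + j₃ + k₂) * jb k₃ := jb_add_le_mul _ _
    _ ≤ jb (j₁ + j₂ + j₃) * jb k₂ * jb k₃ := by gcongr; exact jb_add_le_mul _ _
    _ ≤ jb (j₁ + j₂) * jb j₃ * jb k₂ * jb k₃ := by gcongr; exact jb_add_le_mul _ _
    _ ≤ _ := by gcongr; exact jb_add_le_mul _ _

lemma rpow_neg_mul_self {x : ℝ} (hx : 0 < x) (p : ℝ) : x ^ (-p) * x ^ p = 1 := by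
  rw [← Real.rpow_add hx]; simp

lemma jb_rpow_mul_le {p : ℝ} (hp : 0 ≤ p) (hp2 : p ≤ 2) (j₁ j₂ j₃ : ℤ) :
    jb (j₁ + j₂ + j₃) ^ p * (jb j₁ ^ (-p) * jb j₂ ^ (-p) * jb j₃ ^ (-p)) ≤
      9 * (jb j₁ ^ (-p) * jb j₂ ^ (-p) + jb j₂ ^ (-p) * jb j₃ ^ (-p) +
        jb j₁ ^ (-p) * jb j₃ ^ (-p)) := by
  have h₁ := jb_pos j₁; have h₂ := jb_pos j₂; have h₃ := jb_pos j₃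
  have h₀ := jb_pos (j₁ + j₂ + j₃)
  have hsum : jb (j₁ + j₂ + j₃) ≤ jb j₁ + jb j₂ + jb j₃ := by
    unfold jb; push_cast
    linarith [abs_add_le ((j₁ : ℝ) + j₂) j₃, abs_add_le (j₁ : ℝ) j₂]
  have h9 : (3 : ℝ) ^ p ≤ 9 := by
    calc (3 : ℝ) ^ p ≤ 3 ^ (2 : ℝ) := Real.rpow_le_rpow_of_exponent_le (by norm_num) hp2
      _ = 9 := by norm_num
  have key : ∀ x : ℝ, 0 < x → jb (j₁ + j₂ + j₃) ≤ 3 * x →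
      jb (j₁ + j₂ + j₃) ^ p * x ^ (-p) ≤ 9 := by
    intro x hx hle
    calc jb (j₁ + j₂ + j₃) ^ p * x ^ (-p) ≤ (3 * x) ^ p * x ^ (-p) := by gcongr
      _ = 3 ^ p * (x ^ (-p) * x ^ p) := by rw [Real.mul_rpow (by norm_num) hx.le]; ring
      _ ≤ 9 := by rw [rpow_neg_mul_self hx, mul_one]; exact h9
  have w₁ : 0 ≤ jb j₁ ^ (-p) := by positivity
  have w₂ : 0 ≤ jb j₂ ^ (-p) := by positivity
  have w₃ : 0 ≤ jb j₃ ^ (-p) := by positivity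
  have m₁₂ := mul_nonneg w₁ w₂
  have m₂₃ := mul_nonneg w₂ w₃
  have m₁₃ := mul_nonneg w₁ w₃
  have hmax : jb (j₁ + j₂ + j₃) ≤ 3 * jb j₁ ∨ jb (j₁ + j₂ + j₃) ≤ 3 * jb j₂ ∨
      jb (j₁ + j₂ + j₃) ≤ 3 * jb j₃ := by
    by_contra! hcon
    linarith [hcon.1, hcon.2.1, hcon.2.2]
  rcases hmax with hle | hle | hle
  · linarith [mul_le_mul_of_nonneg_right (key _ h₁ hle) m₂₃]
  · linarith [mul_le_mul_of_nonneg_right (key _ h₂ hle) m₁₃]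
  · linarith [mul_le_mul_of_nonneg_right (key _ h₃ hle) m₁₂]

lemma pow_four_mul_div_le {x y z X Y : ℝ} (hx : 1 ≤ x) (hy : 1 ≤ y) (hz : 1 ≤ z)
    (hX : 0 ≤ X) (hY : 0 ≤ Y)
    (h : y ≤ x / 4 → z ≤ x / 4 → X ≤ 4 / x ∧ Y ≤ 4 / x) :
    x ^ 4 * (X * Y) / (x * y * z) ^ 2 ≤ 16 * (X * Y) + 16 * (1 / y ^ 2 * (1 / z ^ 2)) := by
  have hXY := mul_nonneg hX hY
  have e : x ^ 4 * (X * Y) / (x * y * z) ^ 2 = x ^ 2 * (X * Y) / (y ^ 2 * z ^ 2) := by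
    field_simp
  have hpos : 0 ≤ 16 * (1 / y ^ 2 * (1 / z ^ 2)) := by positivity
  have large : ∀ a b : ℝ, 1 ≤ a → 1 ≤ b → x / 4 < a →
      x ^ 2 * (X * Y) / (a ^ 2 * b ^ 2) ≤ 16 * (X * Y) := by
    intro a b ha hb hlt
    rw [div_le_iff₀ (by positivity)]
    have h1 : x ^ 2 ≤ 16 * (a ^ 2 * b ^ 2) := by
      have : 1 ≤ b ^ 2 := by nlinarith
      nlinarith [mul_le_mul_of_nonneg_left this (sq_nonneg a)]
    nlinarith [mul_le_mul_of_nonneg_right h1 hXY]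
  rw [e]
  by_cases h1 : y ≤ x / 4
  · by_cases h2 : z ≤ x / 4
    · obtain ⟨hX', hY'⟩ := h h1 h2
      have : x ^ 2 * (X * Y) ≤ 16 := by
        calc x ^ 2 * (X * Y) ≤ x ^ 2 * (4 / x * (4 / x)) := by gcongr
          _ = 16 := by field_simp; norm_num
      have : x ^ 2 * (X * Y) / (y ^ 2 * z ^ 2) ≤ 16 / (y ^ 2 * z ^ 2) := by gcongr
      have e' : 16 / (y ^ 2 * z ^ 2) = 16 * (1 / y ^ 2 * (1 / z ^ 2)) := by field_simp
      linarith
    · have := large z y hz hy (not_le.mp h2)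
      rw [mul_comm (z ^ 2)] at this
      linarith
  · linarith [large y z hy hz (not_le.mp h1)]

lemma one_div_sq_le_jb_rpow {p : ℝ} (hp2 : p ≤ 2) {a : ℤ} (ha : a ≠ 0) :
    1 / |(a : ℝ)| ^ 2 ≤ 4 * jb a ^ (-p) := by
  have h1 : (1 : ℝ) ≤ |(a : ℝ)| := by exact_mod_cast Int.one_le_abs ha
  have h2 := jb_le_two_mul_abs ha
  have h0 := jb_pos a
  calc 1 / |(a : ℝ)| ^ 2 ≤ 4 / jb a ^ 2 := by
        rw [div_le_div_iff₀ (by positivity) (by positivity)]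
        nlinarith
    _ = 4 * jb a ^ (-2 : ℝ) := by
        rw [Real.rpow_neg h0.le]; norm_num [div_eq_mul_inv]
    _ ≤ _ := by
        gcongr
        exact one_le_jb a

lemma jb_rpow_neg_le {p x : ℝ} (hp : 1 ≤ p) (hx : 0 < x) {k : ℤ} (h : x / 4 ≤ jb k) :
    jb k ^ (-p) ≤ 4 / x := by
  calc jb k ^ (-p) ≤ jb k ^ (-1 : ℝ) :=
        Real.rpow_le_rpow_of_exponent_le (one_le_jb k) (by linarith)
    _ = (jb k)⁻¹ := by rw [Real.rpow_neg_one]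
    _ ≤ (x / 4)⁻¹ := by gcongr
    _ = 4 / x := by rw [inv_div]

lemma exists_max_of_three {α : Type*} [LinearOrder α] (x y z : α) :
    (y ≤ x ∧ z ≤ x) ∨ (x ≤ y ∧ z ≤ y) ∨ (x ≤ z ∧ y ≤ z) := by
  grind

lemma two_mul_abs_le {x a b c : ℝ} (h : x * 2 = a + b + c) : |x| * 2 ≤ |a| + |b| + |c| := by
  rw [show |x| * 2 = |x * 2| by rw [abs_mul, abs_two], h]
  exact abs_add_three a b c

lemma le_two_mul_abs {x a b c : ℝ} (h : x * 2 = a + b + c) : |a| - |b| - |c| ≤ |x| * 2 := by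
  have := abs_add_three (x * 2) (-b) (-c)
  rw [show x * 2 + -b + -c = a by linarith, abs_mul, abs_two, abs_neg, abs_neg] at this
  linarith

/-- The nonresonant trilinear weight is dominated by products of one-variable weights in two
independent frequencies. -/
lemma trilinear_weight_le {p : ℝ} (hp : 1 ≤ p) (hp2 : p ≤ 2) {k₁ k₂ k₃ : ℤ}
    (hΦ : Phi k₁ k₂ k₃ ≠ 0) :
    ((k₁ + k₂ + k₃ : ℤ) : ℝ) ^ 2 * jb (k₁ + k₂ + k₃) ^ p * jb k₁ ^ (2 - p) *
        (jb k₂ ^ (-p) * jb k₃ ^ (-p)) / ((Phi k₁ k₂ k₃ : ℤ) : ℝ) ^ 2 ≤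
      576 * (jb k₂ ^ (-p) * jb k₃ ^ (-p) + jb (k₁ + k₂) ^ (-p) * jb (k₂ + k₃) ^ (-p) +
        jb (k₂ + k₃) ^ (-p) * jb (k₃ + k₁) ^ (-p) +
        jb (k₁ + k₂) ^ (-p) * jb (k₃ + k₁) ^ (-p)) := by
  rw [Phi_eq] at hΦ ⊢
  have ha : k₁ + k₂ ≠ 0 := by rintro h; simp [h] at hΦ
  have hb : k₂ + k₃ ≠ 0 := by rintro h; simp [h] at hΦ
  have hc : k₃ + k₁ ≠ 0 := by rintro h; simp [h] at hΦ
  have wa := one_div_sq_le_jb_rpow hp2 ha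
  have wb := one_div_sq_le_jb_rpow hp2 hb
  have wc := one_div_sq_le_jb_rpow hp2 hc
  have ea : k₂ * 2 = (k₁ + k₂) + (k₂ + k₃) - (k₃ + k₁) := by ring
  have eb : k₃ * 2 = (k₂ + k₃) + (k₃ + k₁) - (k₁ + k₂) := by ring
  have ec : k₁ * 2 = (k₁ + k₂) + (k₃ + k₁) - (k₂ + k₃) := by ring
  have ed : (k₁ + k₂ + k₃) * 2 = (k₁ + k₂) + (k₂ + k₃) + (k₃ + k₁) := by ring
  have na := Real.rpow_nonneg (jb_pos (k₁ + k₂)).le (-p)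
  have nb := Real.rpow_nonneg (jb_pos (k₂ + k₃)).le (-p)
  have nc := Real.rpow_nonneg (jb_pos (k₃ + k₁)).le (-p)
  have n₂ := Real.rpow_nonneg (jb_pos k₂).le (-p)
  have n₃ := Real.rpow_nonneg (jb_pos k₃).le (-p)
  have pk := jb_pos (k₁ + k₂ + k₃)
  have pk₁ := jb_pos k₁
  have ja : jb (k₁ + k₂ + k₃) = 1 + |((k₁ + k₂ + k₃ : ℤ) : ℝ)| := rfl
  have j₁ : jb k₁ = 1 + |(k₁ : ℝ)| := rfl
  have j₂ : jb k₂ = 1 + |(k₂ : ℝ)| := rfl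
  have j₃ : jb k₃ = 1 + |(k₃ : ℝ)| := rfl
  rw [← sq_abs ((k₁ + k₂ + k₃ : ℤ) : ℝ),
    ← sq_abs ((3 * (k₁ + k₂) * (k₂ + k₃) * (k₃ + k₁) : ℤ) : ℝ)]
  generalize hA : k₁ + k₂ = a at *
  generalize hB : k₂ + k₃ = b at *
  generalize hC : k₃ + k₁ = c at *
  generalize hK : a + k₃ = k at *
  have a1 : (1 : ℝ) ≤ |(a : ℝ)| := by exact_mod_cast Int.one_le_abs ha
  have b1 : (1 : ℝ) ≤ |(b : ℝ)| := by exact_mod_cast Int.one_le_abs hb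
  have c1 : (1 : ℝ) ≤ |(c : ℝ)| := by exact_mod_cast Int.one_le_abs hc
  have ea' : (k₂ : ℝ) * 2 = a + b - c := by exact_mod_cast ea
  have eb' : (k₃ : ℝ) * 2 = b + c - a := by exact_mod_cast eb
  have ec' : (k₁ : ℝ) * 2 = a + c - b := by exact_mod_cast ec
  have ed' : (k : ℝ) * 2 = a + b + c := by exact_mod_cast ed
  have eΦ : |((3 * a * b * c : ℤ) : ℝ)| = 3 * (|(a : ℝ)| * |(b : ℝ)| * |(c : ℝ)|) := by
    push_cast; simp only [abs_mul]; norm_num; ring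
  rw [eΦ]
  have reduce : ∀ D P : ℝ, 0 < D → |(k : ℝ)| ≤ 3 / 2 * D → jb k ≤ 3 * D → jb k₁ ≤ 3 * D →
      D ^ 4 * (jb k₂ ^ (-p) * jb k₃ ^ (-p)) / (|(a : ℝ)| * |(b : ℝ)| * |(c : ℝ)|) ^ 2 ≤ P →
      |(k : ℝ)| ^ 2 * jb k ^ p * jb k₁ ^ (2 - p) * (jb k₂ ^ (-p) * jb k₃ ^ (-p)) /
        (3 * (|(a : ℝ)| * |(b : ℝ)| * |(c : ℝ)|)) ^ 2 ≤ 9 / 4 * P := by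
    intro D P hD hk hjk hjk₁ hP
    have hpow : jb k ^ p * jb k₁ ^ (2 - p) ≤ 9 * D ^ 2 := by
      calc jb k ^ p * jb k₁ ^ (2 - p) ≤ (3 * D) ^ p * (3 * D) ^ (2 - p) := by
            gcongr
        _ = 9 * D ^ 2 := by
            rw [← Real.rpow_add (by positivity)]
            norm_num
            ring
    calc _ = |(k : ℝ)| ^ 2 * (jb k ^ p * jb k₁ ^ (2 - p)) * (jb k₂ ^ (-p) * jb k₃ ^ (-p)) /
            (3 * (|(a : ℝ)| * |(b : ℝ)| * |(c : ℝ)|)) ^ 2 := by ring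
      _ ≤ (3 / 2 * D) ^ 2 * (9 * D ^ 2) * (jb k₂ ^ (-p) * jb k₃ ^ (-p)) /
            (3 * (|(a : ℝ)| * |(b : ℝ)| * |(c : ℝ)|)) ^ 2 := by gcongr
      _ = 9 / 4 * (D ^ 4 * (jb k₂ ^ (-p) * jb k₃ ^ (-p)) /
            (|(a : ℝ)| * |(b : ℝ)| * |(c : ℝ)|) ^ 2) := by ring
      _ ≤ _ := by gcongr
  have bound : ∀ D x y wx wy P : ℝ, 1 ≤ D → 1 ≤ x → 1 ≤ y → x ≤ D → y ≤ D →
      |(a : ℝ)| * |(b : ℝ)| * |(c : ℝ)| = D * x * y →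
      |(k : ℝ)| * 2 ≤ D + x + y → |(k₁ : ℝ)| * 2 ≤ D + x + y →
      D - x - y ≤ |(k₂ : ℝ)| * 2 → D - x - y ≤ |(k₃ : ℝ)| * 2 →
      1 / x ^ 2 ≤ 4 * wx → 1 / y ^ 2 ≤ 4 * wy → 0 ≤ wx →
      jb k₂ ^ (-p) * jb k₃ ^ (-p) + wx * wy ≤ P →
      |(k : ℝ)| ^ 2 * jb k ^ p * jb k₁ ^ (2 - p) * (jb k₂ ^ (-p) * jb k₃ ^ (-p)) /
        (3 * (|(a : ℝ)| * |(b : ℝ)| * |(c : ℝ)|)) ^ 2 ≤ 576 * P := by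
    intro D x y wx wy P hD hx hy hxD hyD hprod hk hk₁ hk₂ hk₃ hwx hwy hwx0 hP
    refine (reduce D _ (by linarith) (by linarith) (by linarith) (by linarith) ?_).trans
      (b := 9 / 4 * (16 * (jb k₂ ^ (-p) * jb k₃ ^ (-p)) + 16 * (1 / x ^ 2 * (1 / y ^ 2)))) ?_
    · rw [hprod]
      exact pow_four_mul_div_le hD hx hy n₂ n₃ fun h h' =>
        ⟨jb_rpow_neg_le hp (by linarith) (by linarith),
          jb_rpow_neg_le hp (by linarith) (by linarith)⟩
    · have h1 : 1 / x ^ 2 * (1 / y ^ 2) ≤ 4 * wx * (4 * wy) := by gcongr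
      linarith [mul_nonneg n₂ n₃]
  have mab := mul_nonneg na nb
  have mbc := mul_nonneg nb nc
  have mac := mul_nonneg na nc
  have tk := two_mul_abs_le ed'
  have tk₁ : |(k₁ : ℝ)| * 2 ≤ |(a : ℝ)| + |(b : ℝ)| + |(c : ℝ)| := by
    simpa using two_mul_abs_le (x := k₁) (a := a) (b := -b) (c := c) (by linarith)
  have la₂ : |(a : ℝ)| - |(b : ℝ)| - |(c : ℝ)| ≤ |(k₂ : ℝ)| * 2 := by
    simpa using le_two_mul_abs (x := k₂) (a := a) (b := b) (c := -c) (by linarith)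
  have la₃ : |(a : ℝ)| - |(b : ℝ)| - |(c : ℝ)| ≤ |(k₃ : ℝ)| * 2 := by
    simpa using le_two_mul_abs (x := k₃) (a := -a) (b := b) (c := c) (by linarith)
  have lb₂ : |(b : ℝ)| - |(a : ℝ)| - |(c : ℝ)| ≤ |(k₂ : ℝ)| * 2 := by
    simpa using le_two_mul_abs (x := k₂) (a := b) (b := a) (c := -c) (by linarith)
  have lb₃ : |(b : ℝ)| - |(a : ℝ)| - |(c : ℝ)| ≤ |(k₃ : ℝ)| * 2 := by
    simpa using le_two_mul_abs (x := k₃) (a := b) (b := -a) (c := c) (by linarith)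
  have lc₂ : |(c : ℝ)| - |(a : ℝ)| - |(b : ℝ)| ≤ |(k₂ : ℝ)| * 2 := by
    simpa using le_two_mul_abs (x := k₂) (a := -c) (b := a) (c := b) (by linarith)
  have lc₃ : |(c : ℝ)| - |(a : ℝ)| - |(b : ℝ)| ≤ |(k₃ : ℝ)| * 2 := by
    simpa using le_two_mul_abs (x := k₃) (a := c) (b := -a) (c := b) (by linarith)
  rcases exists_max_of_three |(a : ℝ)| |(b : ℝ)| |(c : ℝ)| with ⟨h, h'⟩ | ⟨h, h'⟩ | ⟨h, h'⟩
  · exact bound _ _ _ _ _ _ a1 b1 c1 h h' (by ring) (by linarith) (by linarith) la₂ la₃ wb wc nb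
      (by linarith)
  · exact bound _ _ _ _ _ _ b1 a1 c1 h h' (by ring) (by linarith) (by linarith) lb₂ lb₃ wa wc na
      (by linarith)
  · exact bound _ _ _ _ _ _ c1 a1 b1 h h' (by ring) (by linarith) (by linarith) lc₂ lc₃ wa wb na
      (by linarith)

lemma M2_sq_eq (s : ℝ) (j₁ j₂ j₃ k₂ k₃ : ℤ) :
    M2 s j₁ j₂ j₃ k₂ k₃ ^ 2 =
      (jb (j₁ + j₂ + j₃) ^ (2 * s) *
        (jb j₁ ^ (-(2 * s)) * jb j₂ ^ (-(2 * s)) * jb j₃ ^ (-(2 * s)))) *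
      (((j₁ + j₂ + j₃ + k₂ + k₃ : ℤ) : ℝ) ^ 2 * jb (j₁ + j₂ + j₃ + k₂ + k₃) ^ (2 * s) *
        jb (j₁ + j₂ + j₃) ^ (2 - 2 * s) * (jb k₂ ^ (-(2 * s)) * jb k₃ ^ (-(2 * s))) /
        ((Phi (j₁ + j₂ + j₃) k₂ k₃ : ℤ) : ℝ) ^ 2) := by
  have hsq : ∀ k : ℤ, jb k ^ (2 * s) = (jb k ^ s) ^ 2 := fun k => by
    rw [← Real.rpow_natCast, ← Real.rpow_mul (jb_pos k).le, mul_comm]; norm_num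
  have hneg : ∀ k : ℤ, jb k ^ (-(2 * s)) = ((jb k ^ s) ^ 2)⁻¹ := fun k => by
    rw [Real.rpow_neg (jb_pos k).le, hsq]
  have hsplit : jb (j₁ + j₂ + j₃) ^ 2 =
      jb (j₁ + j₂ + j₃) ^ (2 * s) * jb (j₁ + j₂ + j₃) ^ (2 - 2 * s) := by
    rw [← Real.rpow_add (jb_pos _)]; norm_num
  unfold M2
  rw [div_pow]
  simp only [mul_pow, sq_abs]
  rw [hsplit]
  simp only [hneg]
  rw [hsq (j₁ + j₂ + j₃ + k₂ + k₃)]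
  simp only [div_eq_mul_inv, mul_inv]
  ring

lemma summable_jb_rpow {p : ℝ} (hp : 1 < p) : Summable fun k : ℤ => jb k ^ (-p) := by
  refine (Real.summable_abs_int_rpow hp).of_norm_bounded_eventually ?_
  have : ({0} : Set ℤ).Finite := Set.finite_singleton 0
  filter_upwards [this.compl_mem_cofinite] with k hk
  have hk0 : (0 : ℝ) < |(k : ℝ)| := by
    have : k ≠ 0 := hk
    positivity
  rw [Real.norm_of_nonneg (Real.rpow_nonneg (jb_pos k).le _)]
  exact Real.rpow_le_rpow_of_nonpos hk0 (by unfold jb; linarith) (by linarith)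

lemma tsum_prod_five (f₁ f₂ f₃ f₄ f₅ : ℤ → ℝ≥0∞) :
    ∑' q : ℤ × ℤ × ℤ × ℤ × ℤ, f₁ q.1 * (f₂ q.2.1 * (f₃ q.2.2.1 * (f₄ q.2.2.2.1 * f₅ q.2.2.2.2))) =
      (∑' n, f₁ n) * ((∑' n, f₂ n) * ((∑' n, f₃ n) * ((∑' n, f₄ n) * ∑' n, f₅ n))) := by
  have key : ∀ {β : Type} (f : ℤ → ℝ≥0∞) (g : β → ℝ≥0∞),
      ∑' q : ℤ × β, f q.1 * g q.2 = (∑' n, f n) * ∑' b, g b := by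
    intro β f g
    rw [ENNReal.tsum_prod', ← ENNReal.tsum_mul_right]
    simp only [ENNReal.tsum_mul_left]
  rw [key f₁ fun r : ℤ × ℤ × ℤ × ℤ => f₂ r.1 * (f₃ r.2.1 * (f₄ r.2.2.1 * f₅ r.2.2.2)),
    key f₂ fun r : ℤ × ℤ × ℤ => f₃ r.1 * (f₄ r.2.1 * f₅ r.2.2),
    key f₃ fun r : ℤ × ℤ => f₄ r.1 * f₅ r.2, key f₄ f₅]

lemma ENNReal.tsum_mul_le_sqrt_mul_sqrt {ι : Type*} (f g : ι → ℝ≥0∞) :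
    ∑' i, f i * g i ≤ (∑' i, f i ^ 2) ^ (1 / 2 : ℝ) * (∑' i, g i ^ 2) ^ (1 / 2 : ℝ) := by
  let _ : MeasurableSpace ι := ⊤
  have := ENNReal.lintegral_mul_le_Lp_mul_Lq (MeasureTheory.Measure.count : MeasureTheory.Measure ι)
    Real.HolderConjugate.two_two (f := f) (g := g) measurable_from_top.aemeasurable
    measurable_from_top.aemeasurable
  simpa [MeasureTheory.lintegral_count] using this

/-- Independent pairs among the inner frequencies `j₁, j₂, j₃`. -/
def innerPair : Fin 3 → ℤ × ℤ × ℤ × ℤ × ℤ → ℤ × ℤ :=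
  ![fun q => (q.1, q.2.1), fun q => (q.2.1, q.2.2.1), fun q => (q.1, q.2.2.1)]

/-- Independent pairs among `k₂, k₃` and the factors of `Φ`, where `k₁ = j₁ + j₂ + j₃`. -/
def outerPair : Fin 4 → ℤ × ℤ × ℤ × ℤ × ℤ → ℤ × ℤ :=
  ![fun q => (q.2.2.2.1, q.2.2.2.2),
    fun q => (q.1 + q.2.1 + q.2.2.1 + q.2.2.2.1, q.2.2.2.1 + q.2.2.2.2),
    fun q => (q.2.2.2.1 + q.2.2.2.2, q.2.2.2.2 + (q.1 + q.2.1 + q.2.2.1)),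
    fun q => (q.1 + q.2.1 + q.2.2.1 + q.2.2.2.1, q.2.2.2.2 + (q.1 + q.2.1 + q.2.2.1))]

/-- The coordinates consisting of an inner pair, an outer pair and the total frequency. -/
def pairCoords (i : Fin 3) (j : Fin 4) (q : ℤ × ℤ × ℤ × ℤ × ℤ) : ℤ × ℤ × ℤ × ℤ × ℤ :=
  ((innerPair i q).1, (innerPair i q).2, (outerPair j q).1, (outerPair j q).2,
    q.1 + q.2.1 + q.2.2.1 + q.2.2.2.1 + q.2.2.2.2)

lemma pairCoords_injective (i : Fin 3) (j : Fin 4) : Function.Injective (pairCoords i j) := by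
  rintro ⟨a, b, c, d, e⟩ ⟨a', b', c', d', e'⟩ h
  fin_cases i <;> fin_cases j <;>
    simp [pairCoords, innerPair, outerPair] at h ⊢ <;> omega

lemma M2_sq_le {s : ℝ} (hs : 1 / 2 ≤ s) (hs1 : s ≤ 1) (q : ℤ × ℤ × ℤ × ℤ × ℤ)
    (hΦ : Phi (q.1 + q.2.1 + q.2.2.1) q.2.2.2.1 q.2.2.2.2 ≠ 0) :
    M2 s q.1 q.2.1 q.2.2.1 q.2.2.2.1 q.2.2.2.2 ^ 2 ≤
      5184 * ∑ i : Fin 3, ∑ j : Fin 4,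
        (jb (innerPair i q).1 ^ (-(2 * s)) * jb (innerPair i q).2 ^ (-(2 * s))) *
        (jb (outerPair j q).1 ^ (-(2 * s)) * jb (outerPair j q).2 ^ (-(2 * s))) := by
  obtain ⟨j₁, j₂, j₃, k₂, k₃⟩ := q
  have hw := fun k => Real.rpow_nonneg (jb_pos k).le (-(2 * s))
  have hJ := jb_rpow_mul_le (p := 2 * s) (by linarith) (by linarith) j₁ j₂ j₃
  have hK := trilinear_weight_le (p := 2 * s) (by linarith) (by linarith) hΦ
  have n₁ := hw j₁; have n₂ := hw j₂; have n₃ := hw j₃; have n₄ := hw k₂; have n₅ := hw k₃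
  have e := jb_pos (j₁ + j₂ + j₃)
  have e' := jb_pos (j₁ + j₂ + j₃ + k₂ + k₃)
  simp only at hK ⊢
  rw [M2_sq_eq, ← Finset.sum_mul_sum]
  refine (mul_le_mul hJ hK (by positivity) (by positivity)).trans_eq ?_
  simp only [Fin.sum_univ_three, Fin.sum_univ_four, innerPair, outerPair]
  simp
  ring

lemma tsum_sq_mul_le {s : ℝ} (hs : 1 / 2 ≤ s) (hs1 : s ≤ 1) (Z : ℤ → ℝ≥0∞) :
    ∑' q : ℤ × ℤ × ℤ × ℤ × ℤ,
      ((if Phi (q.1 + q.2.1 + q.2.2.1) q.2.2.2.1 q.2.2.2.2 ≠ 0 then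
        ENNReal.ofReal (M2 s q.1 q.2.1 q.2.2.1 q.2.2.2.1 q.2.2.2.2) else 0) *
        Z (q.1 + q.2.1 + q.2.2.1 + q.2.2.2.1 + q.2.2.2.2)) ^ 2 ≤
      ENNReal.ofReal 5184 * (12 * (∑' k : ℤ, ENNReal.ofReal (jb k ^ (-(2 * s)))) ^ 4) *
        ∑' k, Z k ^ 2 := by
  set w : ℤ → ℝ≥0∞ := fun k => ENNReal.ofReal (jb k ^ (-(2 * s))) with hw
  set H : ℤ × ℤ × ℤ × ℤ × ℤ → ℝ≥0∞ := fun y =>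
    w y.1 * (w y.2.1 * (w y.2.2.1 * (w y.2.2.2.1 * Z y.2.2.2.2 ^ 2))) with hH
  have hn := fun k => Real.rpow_nonneg (jb_pos k).le (-(2 * s))
  calc _ ≤ ∑' q, ENNReal.ofReal 5184 * ∑ i : Fin 3, ∑ j : Fin 4, H (pairCoords i j q) := by
        refine ENNReal.tsum_le_tsum fun q => ?_
        split_ifs with hΦ
        · have h := ENNReal.ofReal_le_ofReal (M2_sq_le hs hs1 q hΦ)
          rw [ENNReal.ofReal_pow (M2_nonneg ..), ENNReal.ofReal_mul (by norm_num),
            ENNReal.ofReal_sum_of_nonneg fun i _ => Finset.sum_nonneg fun j _ =>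
              mul_nonneg (mul_nonneg (hn _) (hn _)) (mul_nonneg (hn _) (hn _))] at h
          rw [mul_pow]
          refine (mul_le_mul_left h _).trans_eq ?_
          rw [mul_assoc, Finset.sum_mul]
          congr 1
          refine Finset.sum_congr rfl fun i _ => ?_
          rw [ENNReal.ofReal_sum_of_nonneg fun j _ =>
              mul_nonneg (mul_nonneg (hn _) (hn _)) (mul_nonneg (hn _) (hn _)), Finset.sum_mul]
          refine Finset.sum_congr rfl fun j _ => ?_
          rw [ENNReal.ofReal_mul (mul_nonneg (hn _) (hn _)), ENNReal.ofReal_mul (hn _),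
            ENNReal.ofReal_mul (hn _)]
          simp only [hH, hw, pairCoords]
          ring
        · simp
    _ = ENNReal.ofReal 5184 * ∑ i : Fin 3, ∑ j : Fin 4, ∑' q, H (pairCoords i j q) := by
        rw [ENNReal.tsum_mul_left, Summable.tsum_finsetSum fun _ _ => ENNReal.summable]
        congr 1
        exact Finset.sum_congr rfl fun i _ =>
          Summable.tsum_finsetSum fun _ _ => ENNReal.summable
    _ ≤ ENNReal.ofReal 5184 * ∑ i : Fin 3, ∑ j : Fin 4, ∑' y, H y := by
        refine mul_le_mul_right (Finset.sum_le_sum fun i _ => Finset.sum_le_sum fun j _ => ?_) _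
        exact ENNReal.tsum_comp_le_tsum_of_injective (pairCoords_injective i j) H
    _ = _ := by
        rw [hH, tsum_prod_five w w w w fun n => Z n ^ 2]
        simp
        ring

/-- Weighted quintic convolution estimate with multiplier `M₂`, for `s > 1/2`.
The sum runs over `(j₁, j₂, j₃, k₂, k₃)`, with `k₁ = j₁ + j₂ + j₃`,
`k = k₁ + k₂ + k₃`, and `Φ(k̄) ≠ 0`. -/
theorem M2_estimate (s : ℝ) (hs : 1 / 2 < s) :
    ∃ C > (0 : ℝ), ∀ u z : ℤ → ℝ, (∀ k, 0 ≤ u k) → (∀ k, 0 ≤ z k) →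
      l2 u < ⊤ → l2 z < ⊤ →
      (∑' q : ℤ × ℤ × ℤ × ℤ × ℤ,
        ENNReal.ofReal
          (if Phi (q.1 + q.2.1 + q.2.2.1) q.2.2.2.1 q.2.2.2.2 ≠ 0 then
            M2 s q.1 q.2.1 q.2.2.1 q.2.2.2.1 q.2.2.2.2 *
              (u q.1 * u q.2.1 * u q.2.2.1 * u q.2.2.2.1 * u q.2.2.2.2 *
                z (q.1 + q.2.1 + q.2.2.1 + q.2.2.2.1 + q.2.2.2.2))
          else 0)) ≤ ENNReal.ofReal C * l2 u ^ 5 * l2 z := by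
  set r := min s 1 with hr
  have hr2 : 1 / 2 < r := lt_min hs (by norm_num)
  have hr1 : r ≤ 1 := min_le_right _ _
  set T : ℝ≥0∞ :=
    ENNReal.ofReal 5184 * (12 * (∑' k : ℤ, ENNReal.ofReal (jb k ^ (-(2 * r)))) ^ 4) with hT
  have hTtop : T ≠ ⊤ :=
    ENNReal.mul_ne_top ENNReal.ofReal_ne_top (ENNReal.mul_ne_top (by norm_num)
      (ENNReal.pow_ne_top (summable_jb_rpow (by linarith)).tsum_ofReal_ne_top))
  have hT2 : T ^ (1 / 2 : ℝ) ≠ ⊤ := ENNReal.rpow_ne_top_of_nonneg (by norm_num) hTtop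
  refine ⟨(T ^ (1 / 2 : ℝ)).toReal + 1, by positivity, fun u z hu hz _ _ => ?_⟩
  have hTC : T ^ (1 / 2 : ℝ) ≤ ENNReal.ofReal ((T ^ (1 / 2 : ℝ)).toReal + 1) := by
    rw [← ENNReal.ofReal_toReal hT2]
    apply ENNReal.ofReal_le_ofReal
    rw [ENNReal.toReal_ofReal ENNReal.toReal_nonneg]
    linarith
  set U : ℤ → ℝ≥0∞ := fun k => ENNReal.ofReal (u k) with hU
  set Z : ℤ → ℝ≥0∞ := fun k => ENNReal.ofReal (z k) with hZ
  have lu : l2 u = (∑' k, U k ^ 2) ^ (1 / 2 : ℝ) := by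
    simp only [l2, hU, ENNReal.ofReal_pow (hu _)]
  have lz : l2 z = (∑' k, Z k ^ 2) ^ (1 / 2 : ℝ) := by
    simp only [l2, hZ, ENNReal.ofReal_pow (hz _)]
  calc _ ≤ ∑' q : ℤ × ℤ × ℤ × ℤ × ℤ,
        (U q.1 * (U q.2.1 * (U q.2.2.1 * (U q.2.2.2.1 * U q.2.2.2.2)))) *
        ((if Phi (q.1 + q.2.1 + q.2.2.1) q.2.2.2.1 q.2.2.2.2 ≠ 0 then
          ENNReal.ofReal (M2 r q.1 q.2.1 q.2.2.1 q.2.2.2.1 q.2.2.2.2) else 0) *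
          Z (q.1 + q.2.1 + q.2.2.1 + q.2.2.2.1 + q.2.2.2.2)) := by
        refine ENNReal.tsum_le_tsum fun q => ?_
        split_ifs with hΦ
        · have n₁ := hu q.1; have n₂ := hu q.2.1; have n₃ := hu q.2.2.1
          have n₄ := hu q.2.2.2.1; have n₅ := hu q.2.2.2.2
          rw [ENNReal.ofReal_mul (M2_nonneg ..), ENNReal.ofReal_mul (by positivity),
            ENNReal.ofReal_mul (by positivity), ENNReal.ofReal_mul (by positivity),
            ENNReal.ofReal_mul (by positivity), ENNReal.ofReal_mul n₁]
          refine (mul_le_mul_left (ENNReal.ofReal_le_ofReal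
            (M2_anti (min_le_left s 1) ..)) _).trans_eq ?_
          simp only [hU, hZ, hr]
          ring
        · simp
    _ ≤ ((∑' k, U k ^ 2) ^ 5) ^ (1 / 2 : ℝ) * (T * ∑' k, Z k ^ 2) ^ (1 / 2 : ℝ) := by
        refine (ENNReal.tsum_mul_le_sqrt_mul_sqrt _ _).trans ?_
        gcongr
        · simp only [mul_pow]
          rw [tsum_prod_five (fun k => U k ^ 2) (fun k => U k ^ 2) (fun k => U k ^ 2)
            (fun k => U k ^ 2) fun k => U k ^ 2]
          exact le_of_eq (by ring)
        · exact tsum_sq_mul_le hr2.le hr1 Z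
    _ = T ^ (1 / 2 : ℝ) * l2 u ^ 5 * l2 z := by
        rw [ENNReal.mul_rpow_of_nonneg _ _ (by norm_num), lu, lz, ← ENNReal.rpow_natCast,
          ← ENNReal.rpow_natCast, ← ENNReal.rpow_mul, ← ENNReal.rpow_mul, mul_comm (1 / 2 : ℝ)]
        ring
    _ ≤ _ := by gcongr
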